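/- Let A_0,A_1,A_2 be C^∞ m×m matrix functions supported in B_R, let c₊(x,t) and c₋(x,t) be as in Lemma 2.1 (c₊ on closure(B_{2R})×closure(D⁺), c₋ on closure(B_{2R})×closure(D⁻), solving ζ(t)·∂c_±/∂x = A(x,ζ(t))c_±, smooth, invertible, analytic in t, with c₊ analytic at t=∞). Let f be C^∞ supported in B_R and u_±(x,t) = c_±(x,t)·(Π(t)(c_±(·,t)^{-1}f))(x). Then: (i) ∮_{|t|=ρ′} u₋(x,t) dt = 0 for every 0<ρ′<1; and (ii) for every ρ>1 and every x∈B_{2R}, the attenuated non-abelian Radon inversion formula holds: f(x) = c₊(x,∞)·∂/∂z̄ [ c₊(x,∞)^{-1} · (1/(2πi))∮_{|t|=ρ} u₊(x,t) dt ]. -/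

import Mathlib

noncomputable section

open MeasureTheory Filter Topology Complex Matrix

abbrev R2 : Type := EuclideanSpace ℝ (Fin 2)
abbrev Mat (m : ℕ) : Type := Matrix (Fin m) (Fin m) ℂ
abbrev Vec (m : ℕ) : Type := Fin m → ℂ

/-- the point (a,b) ∈ ℝ² -/
def mk2 (a b : ℝ) : R2 := (WithLp.equiv 2 (Fin 2 → ℝ)).symm ![a, b]
def e1 : R2 := mk2 1 0
def e2 : R2 := mk2 0 1

/-- partial derivative of a scalar function in direction v -/
def pdv (v : R2) (f : R2 → ℂ) (x : R2) : ℂ := fderiv ℝ f x v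

def zeta1 (t : ℂ) : ℂ := (t + t⁻¹) / 2
def zeta2 (t : ℂ) : ℂ := (t - t⁻¹) / (2 * Complex.I)

/-- z = x₁ + i x₂ -/
def zOf (x : R2) : ℂ := (x 0 : ℂ) + Complex.I * (x 1 : ℂ)

/-- the kernel denominator t(z−z′)+t⁻¹(z̄−z̄′) -/
def ker (t : ℂ) (x y : R2) : ℂ :=
  t * (zOf x - zOf y) + t⁻¹ * (starRingEnd ℂ) (zOf x - zOf y)

/-- ζ·∂c/∂x for a matrix-valued function, entrywise -/
def zDirM {m : ℕ} (z1 z2 : ℂ) (c : R2 → Mat m) (x : R2) : Mat m :=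
  Matrix.of fun i j => z1 * pdv e1 (fun y => c y i j) x + z2 * pdv e2 (fun y => c y i j) x

def zDirV {m : ℕ} (z1 z2 : ℂ) (u : R2 → Vec m) (x : R2) : Vec m :=
  fun i => z1 * pdv e1 (fun y => u y i) x + z2 * pdv e2 (fun y => u y i) x

/-- ∂/∂z̄ of a matrix-valued function -/
def dzbarM {m : ℕ} (c : R2 → Mat m) (x : R2) : Mat m :=
  Matrix.of fun i j =>
    (pdv e1 (fun y => c y i j) x + Complex.I * pdv e2 (fun y => c y i j) x) / 2

def dzbarV {m : ℕ} (u : R2 → Vec m) (x : R2) : Vec m :=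
  fun i => (pdv e1 (fun y => u y i) x + Complex.I * pdv e2 (fun y => u y i) x) / 2

def dzM {m : ℕ} (c : R2 → Mat m) (x : R2) : Mat m :=
  Matrix.of fun i j =>
    (pdv e1 (fun y => c y i j) x - Complex.I * pdv e2 (fun y => c y i j) x) / 2

/-- the operator Π(t), matrix-valued version -/
def PiTM {m : ℕ} (t : ℂ) (f : R2 → Mat m) (x : R2) : Mat m :=
  Matrix.of fun i j => (Real.pi : ℂ)⁻¹ * ∫ y : R2, f y i j / ker t x y

def PiTV {m : ℕ} (t : ℂ) (f : R2 → Vec m) (x : R2) : Vec m :=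
  fun i => (Real.pi : ℂ)⁻¹ * ∫ y : R2, f y i / ker t x y

/-- the Cauchy transform S -/
def CauchyM {m : ℕ} (f : R2 → Mat m) (x : R2) : Mat m :=
  Matrix.of fun i j => (Real.pi : ℂ)⁻¹ * ∫ y : R2, f y i j / (zOf x - zOf y)

def CauchyV {m : ℕ} (f : R2 → Vec m) (x : R2) : Vec m :=
  fun i => (Real.pi : ℂ)⁻¹ * ∫ y : R2, f y i / (zOf x - zOf y)

/-- the contour integral ∮_{|t|=ρ} F(t) dt -/
def circIntM {m : ℕ} (F : ℂ → Mat m) (ρ : ℝ) : Mat m :=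
  Matrix.of fun i j => ∫ φ in (0:ℝ)..(2*Real.pi),
    F ((ρ:ℂ) * Complex.exp (Complex.I * φ)) i j * (Complex.I * ρ * Complex.exp (Complex.I * φ))

def circIntV {m : ℕ} (F : ℂ → Vec m) (ρ : ℝ) : Vec m :=
  fun i => ∫ φ in (0:ℝ)..(2*Real.pi),
    F ((ρ:ℂ) * Complex.exp (Complex.I * φ)) i * (Complex.I * ρ * Complex.exp (Complex.I * φ))

def MatSmooth {m : ℕ} (c : R2 → Mat m) : Prop := ∀ i j, ContDiff ℝ (⊤ : ℕ∞) (fun x => c x i j)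

def SuppIn {m : ℕ} (A : R2 → Mat m) (R : ℝ) : Prop := ∀ x : R2, R ≤ ‖x‖ → A x = 0

/-- A(x,ζ) = ζ₁A₁(x)+ζ₂A₂(x)+A₀(x) -/
def Acomb {m : ℕ} (A0 A1 A2 : R2 → Mat m) (z1 z2 : ℂ) (x : R2) : Mat m :=
  z1 • A1 x + z2 • A2 x + A0 x

/-- c solves θ·∂c/∂x = M(x)c along every line in direction θ -/
def Transport {m : ℕ} (M : R2 → Mat m) (θ : R2) (c : R2 → Mat m) : Prop :=
  ∀ x : R2, ∀ i j, HasDerivAt (fun s : ℝ => c (x + s • θ) i j) ((M x * c x) i j) 0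

open Classical in
/-- extension at infinity: `extInf F L` equals `F (1/s)` for `s ≠ 0` and `L` at `s = 0`;
analyticity of this at `0` encodes analyticity of `F` at `t = ∞` with value `L`. -/
def extInf {m : ℕ} (F : ℂ → Mat m) (L : Mat m) (s : ℂ) : Mat m := if s = 0 then L else F s⁻¹

/-- For a real-linear `L : ℂ → ℂ`, the combination `L 1 + i L i` is conjugate-equivariant. -/
lemma antilinear_part_rotate (L : ℂ →L[ℝ] ℂ) (θ : ℝ) :
    L 1 + I * L I = exp (θ * I) * (L (exp (θ * I)) + I * L (I * exp (θ * I))) := by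
  have h1 : exp (θ * I) = (Real.cos θ) • (1 : ℂ) + (Real.sin θ) • I := by
    rw [exp_mul_I]; simp
  have h2 : I * exp (θ * I) = (-Real.sin θ) • (1 : ℂ) + (Real.cos θ) • I := by
    rw [exp_mul_I]; simp; ring_nf; simp; ring
  rw [h2, h1]
  simp only [map_add, map_smul]
  simp only [real_smul, mul_one]
  have h3 : ((Real.cos θ : ℂ)) ^ 2 + (Real.sin θ : ℂ) ^ 2 = 1 := by
    exact_mod_cast Real.cos_sq_add_sin_sq θ
  push_cast at *
  linear_combination (-(L 1) - I * L I) * h3 + (sin θ ^ 2 * L 1 - cos θ * sin θ * L I) * I_sq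

lemma integrableOn_polar_target {Φ : ℝ × ℝ → ℂ} (hΦ : Continuous Φ) {M : ℝ}
    (hM : ∀ p : ℝ × ℝ, M ≤ p.1 → Φ p = 0) :
    IntegrableOn Φ (Set.Ioi (0 : ℝ) ×ˢ Set.Ioo (-Real.pi) Real.pi) := by
  have h1 : IntegrableOn Φ (Set.Icc 0 M ×ˢ Set.Icc (-Real.pi) Real.pi) :=
    hΦ.continuousOn.integrableOn_compact (isCompact_Icc.prod isCompact_Icc)
  refine h1.of_forall_sdiff_eq_zero (measurableSet_Ioi.prod measurableSet_Ioo) ?_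
  rintro ⟨r, θ⟩ ⟨⟨hr, hθ⟩, hn⟩
  apply hM
  by_contra hlt
  exact hn ⟨⟨le_of_lt hr, (not_le.1 hlt).le⟩, ⟨hθ.1.le, hθ.2.le⟩⟩

/-- The Cauchy–Pompeiu formula for compactly supported functions, at the origin. -/
lemma integral_dzbar_div {h : ℂ → ℂ} (hh : ContDiff ℝ 1 h) (hc : HasCompactSupport h) :
    ∫ w, (fderiv ℝ h w 1 + I * fderiv ℝ h w I) / w = -(2 * Real.pi) * h 0 := by
  have hd : ∀ w, HasFDerivAt h (fderiv ℝ h w) w := fun w =>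
    (hh.differentiable one_ne_zero w).hasFDerivAt
  have hcont : Continuous (fderiv ℝ h) := hh.continuous_fderiv one_ne_zero
  obtain ⟨M, hMpos, hM⟩ := hc.isCompact.isBounded.exists_pos_norm_lt
  have hzero : ∀ w : ℂ, M ≤ ‖w‖ → h w = 0 := fun w hw => by
    by_contra hne
    exact absurd (hM w (subset_tsupport _ hne)) (not_lt.2 hw)
  have hzero' : ∀ w : ℂ, M ≤ ‖w‖ → fderiv ℝ h w = 0 := fun w hw => by
    by_contra hne
    exact absurd (hM w (support_fderiv_subset ℝ hne)) (not_lt.2 hw)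
  let A : ℝ × ℝ → ℂ := fun p => fderiv ℝ h (p.1 * exp (p.2 * I)) (exp (p.2 * I))
  let B : ℝ × ℝ → ℂ := fun p => fderiv ℝ h (p.1 * exp (p.2 * I)) (I * exp (p.2 * I))
  have hAc : Continuous A := (hcont.comp (by fun_prop)).clm_apply (by fun_prop)
  have hBc : Continuous B := (hcont.comp (by fun_prop)).clm_apply (by fun_prop)
  have hn : ∀ p : ℝ × ℝ, M ≤ p.1 → M ≤ ‖(p.1 : ℂ) * exp (p.2 * I)‖ := fun p hp => by
    rw [norm_mul, norm_exp_ofReal_mul_I, norm_real, mul_one]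
    exact hp.trans (le_abs_self _)
  have hAi : IntegrableOn A (Set.Ioi (0 : ℝ) ×ˢ Set.Ioo (-Real.pi) Real.pi) :=
    integrableOn_polar_target hAc (M := M) fun p hp => by simp [A, hzero' _ (hn p hp)]
  have hBi : IntegrableOn B (Set.Ioi (0 : ℝ) ×ˢ Set.Ioo (-Real.pi) Real.pi) :=
    integrableOn_polar_target hBc (M := M) fun p hp => by simp [B, hzero' _ (hn p hp)]
  have hA : ∫ p in Set.Ioi (0 : ℝ) ×ˢ Set.Ioo (-Real.pi) Real.pi, A p
      = -(2 * Real.pi) * h 0 := by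
    have hAi' := hAi
    rw [IntegrableOn, Measure.volume_eq_prod, ← Measure.prod_restrict] at hAi'
    rw [Measure.volume_eq_prod, ← Measure.prod_restrict, integral_prod_symm _ hAi']
    have : ∀ θ : ℝ, ∫ r in Set.Ioi (0 : ℝ), A (r, θ) = 0 - h 0 := fun θ => by
      have hder : ∀ r : ℝ, HasDerivAt (fun r : ℝ => h (r * exp (θ * I))) (A (r, θ)) r := fun r => by
        have h1 : HasDerivAt (fun r : ℝ => (r : ℂ) * exp (θ * I)) (exp (θ * I)) r := by
          simpa using (ofRealCLM.hasDerivAt (x := r)).mul_const (exp (θ * I))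
        exact (hd _).comp_hasDerivAt r h1
      have hcs : ∀ r : ℝ, M ≤ r → A (r, θ) = 0 := fun r hr => by
        simp [A, hzero' _ (hn (r, θ) hr)]
      have := integral_Ioi_of_hasDerivAt_of_tendsto (a := (0 : ℝ)) (m := (0 : ℂ))
        (f := fun r : ℝ => h (r * exp (θ * I))) (f' := fun r => A (r, θ))
        (hder 0).continuousAt.continuousWithinAt (fun r _ => hder r) ?_ ?_
      · simpa using this
      · have h1 : IntegrableOn (fun r => A (r, θ)) (Set.Icc 0 M) :=
          (hAc.comp (by fun_prop : Continuous fun r : ℝ => (r, θ))).continuousOn.integrableOn_compact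
            isCompact_Icc
        refine h1.of_forall_sdiff_eq_zero measurableSet_Ioi ?_
        rintro r ⟨hr, hn'⟩
        apply hcs
        by_contra hlt
        exact hn' ⟨le_of_lt hr, (not_le.1 hlt).le⟩
      · refine tendsto_const_nhds.congr' ?_
        filter_upwards [eventually_ge_atTop M] with r hr
        exact (hzero _ (hn (r, θ) hr)).symm
    simp only [this]
    simp [Measure.real, Real.pi_pos.le]
    left
    ring
  have hB : ∫ p in Set.Ioi (0 : ℝ) ×ˢ Set.Ioo (-Real.pi) Real.pi, B p = 0 := by
    have hBi' := hBi
    rw [IntegrableOn, Measure.volume_eq_prod, ← Measure.prod_restrict] at hBi'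
    rw [Measure.volume_eq_prod, ← Measure.prod_restrict, integral_prod _ hBi']
    refine setIntegral_eq_zero_of_forall_eq_zero fun r hr => ?_
    have hr0 : (r : ℂ) ≠ 0 := by exact_mod_cast (ne_of_gt hr)
    have hder : ∀ θ : ℝ, HasDerivAt (fun θ : ℝ => h (r * exp (θ * I))) (r * B (r, θ)) θ := fun θ => by
      have h1 : HasDerivAt (fun θ : ℝ => (r : ℂ) * exp (θ * I)) (r * (exp (θ * I) * I)) θ := by
        have := ((ofRealCLM.hasDerivAt (x := θ)).mul_const I).cexp.const_mul (r : ℂ)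
        simpa using this
      have h2 := (hd _).comp_hasDerivAt θ h1
      refine h2.congr_deriv ?_
      have : (r : ℂ) * (exp (θ * I) * I) = r • (I * exp (θ * I)) := by
        rw [real_smul]; ring
      rw [this, map_smul, real_smul]
    rw [← integral_Ioc_eq_integral_Ioo,
      ← intervalIntegral.integral_of_le (by linarith [Real.pi_pos])]
    have := intervalIntegral.integral_eq_sub_of_hasDerivAt (a := -Real.pi) (b := Real.pi)
      (fun θ _ => hder θ)
      ((continuous_const.mul (hBc.comp
        (by fun_prop : Continuous fun θ : ℝ => (r, θ)))).intervalIntegrable _ _)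
    rw [intervalIntegral.integral_const_mul] at this
    have h3 : exp (((-Real.pi : ℝ) : ℂ) * I) = exp ((Real.pi : ℂ) * I) := by
      push_cast
      rw [neg_mul, Complex.exp_neg, exp_pi_mul_I]; norm_num
    rw [h3, sub_self] at this
    exact (mul_eq_zero.1 this).resolve_left hr0
  rw [← Complex.integral_comp_polarCoord_symm,
    show _root_.polarCoord.target = Set.Ioi (0 : ℝ) ×ˢ Set.Ioo (-Real.pi) Real.pi from rfl]
  have : ∀ p ∈ Set.Ioi (0 : ℝ) ×ˢ Set.Ioo (-Real.pi) Real.pi,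
      p.1 • ((fderiv ℝ h (Complex.polarCoord.symm p) 1 +
        I * fderiv ℝ h (Complex.polarCoord.symm p) I) / Complex.polarCoord.symm p)
      = A p + I * B p := by
    rintro ⟨r, θ⟩ ⟨hr, -⟩
    have hr0 : (r : ℂ) ≠ 0 := by exact_mod_cast (ne_of_gt hr)
    have hs : Complex.polarCoord.symm (r, θ) = r * exp (θ * I) := by
      rw [Complex.polarCoord_symm_apply, exp_mul_I]; push_cast; rfl
    rw [hs, antilinear_part_rotate _ θ, real_smul]
    have he := exp_ne_zero (θ * I)
    simp only [A, B]
    field_simp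
  rw [setIntegral_congr_fun (measurableSet_Ioi.prod measurableSet_Ioo) this,
    integral_add hAi (hBi.const_mul I), integral_const_mul, hA, hB]
  simp

lemma locallyIntegrable_inv_norm {E : Type*} [NormedAddCommGroup E] [NormedSpace ℝ E]
    [FiniteDimensional ℝ E] [MeasurableSpace E] [BorelSpace E] (μ : Measure E)
    [μ.IsAddHaarMeasure] (hd : 2 ≤ Module.finrank ℝ E) :
    LocallyIntegrable (fun x : E => ‖x‖⁻¹) μ := by
  refine locallyIntegrable_of_norm_le_rpow (C := 1) (α := 1) (by omega) ?_ ?_ ?_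
  · exact_mod_cast (by omega : 1 < Module.finrank ℝ E)
  · refine Eventually.of_forall fun x => ?_
    rw [Real.rpow_neg_one]; simp
  · exact measurable_norm.inv.aestronglyMeasurable

lemma locallyIntegrable_inv : LocallyIntegrable (fun w : ℂ => w⁻¹) := by
  refine (locallyIntegrable_inv_norm (volume : Measure ℂ) (by simp)).mono
    measurable_inv.aestronglyMeasurable (Eventually.of_forall fun x => by simp)

open scoped Convolution in
/-- The Cauchy transform inverts `∂/∂z̄` (up to normalisation) on compactly supported functions. -/
lemma dzbar_cauchy_complex {g : ℂ → ℂ} (hg : ContDiff ℝ 1 g) (hc : HasCompactSupport g) (z : ℂ) :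
    ∃ L : ℂ →L[ℝ] ℂ, HasFDerivAt (fun z => ∫ w, g w / (z - w)) L z ∧
      L 1 + I * L I = 2 * Real.pi * g z := by
  have key := hc.hasFDerivAt_convolution_right (μ := (volume : Measure ℂ))
    (ContinuousLinearMap.mul ℝ ℂ) locallyIntegrable_inv hg z
  have hconv : (fun z => ∫ w, g w / (z - w)) =
      ((fun w : ℂ => w⁻¹) ⋆[ContinuousLinearMap.mul ℝ ℂ] g) := by
    funext z
    rw [convolution_def, ← integral_sub_left_eq_self _ _ z]
    simp [div_eq_inv_mul]
  rw [hconv]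
  refine ⟨_, key, ?_⟩
  have hci : HasCompactSupport (fderiv ℝ g) := hc.fderiv ℝ
  have hint := (hci.convolutionExists_right
    ((ContinuousLinearMap.mul ℝ ℂ).precompR ℂ) locallyIntegrable_inv
    (hg.continuous_fderiv one_ne_zero) z).integrable
  rw [convolution_def, ContinuousLinearMap.integral_apply hint,
    ContinuousLinearMap.integral_apply hint, ← integral_const_mul, ← integral_add
      (hint.apply_continuousLinearMap 1) ((hint.apply_continuousLinearMap I).const_mul I)]
  have hcomp : ContDiff ℝ 1 (fun w => g (z - w)) := hg.comp (by fun_prop)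
  have hcc : HasCompactSupport (fun w => g (z - w)) :=
    hc.comp_homeomorph (Homeomorph.subLeft z)
  have h1 := integral_dzbar_div hcomp hcc
  have h2 : ∀ w, fderiv ℝ (fun w => g (z - w)) w = -fderiv ℝ g (z - w) := fun w => by
    have := ((hg.differentiable one_ne_zero (z - w)).hasFDerivAt).comp w
      ((hasFDerivAt_id (𝕜 := ℝ) w).const_sub z)
    rw [show (fun w => g (z - w)) = g ∘ HSub.hSub z from rfl, this.fderiv]
    ext1
    simp
  simp only [h2, sub_zero] at h1
  rw [← neg_eq_iff_eq_neg.2 (h1.trans (neg_mul _ _)), ← integral_neg]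
  refine integral_congr_ae (Eventually.of_forall fun w => ?_)
  simp [ContinuousLinearMap.precompR]
  ring

lemma zOf_eq_repr_symm (x : R2) : zOf x = Complex.orthonormalBasisOneI.repr.symm x := by
  rw [Complex.orthonormalBasisOneI_repr_symm_apply, zOf, mul_comm]

lemma norm_zOf_sub (x y : R2) : ‖zOf x - zOf y‖ = ‖x - y‖ := by
  rw [zOf_eq_repr_symm, zOf_eq_repr_symm, ← map_sub, LinearIsometryEquiv.norm_map]

lemma zOf_sub_ne_zero {x y : R2} (h : y ≠ x) : zOf x - zOf y ≠ 0 := by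
  rw [← norm_pos_iff, norm_zOf_sub, norm_pos_iff, sub_ne_zero]
  exact h.symm

lemma continuous_zOf : Continuous zOf := by
  unfold zOf
  fun_prop

lemma dzbar_cauchy {g : R2 → ℂ} (hg : ContDiff ℝ 1 g) (hc : HasCompactSupport g) (x : R2) :
    pdv e1 (fun x => ∫ y, g y / (zOf x - zOf y)) x +
      I * pdv e2 (fun x => ∫ y, g y / (zOf x - zOf y)) x = 2 * Real.pi * g x := by
  let e := Complex.orthonormalBasisOneI.repr.symm
  obtain ⟨L, hL, hLe⟩ := dzbar_cauchy_complex (g := g ∘ e.symm) (hg.comp e.symm.contDiff)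
    (hc.comp_homeomorph e.symm.toHomeomorph) (e x)
  have hint : (fun x => ∫ y, g y / (zOf x - zOf y)) =
      (fun z => ∫ w, (g ∘ e.symm) w / (z - w)) ∘ e := by
    funext x
    have := (e.measurePreserving.integral_comp e.toHomeomorph.measurableEmbedding)
      (fun w => (g ∘ e.symm) w / (e x - w))
    rw [Function.comp_apply, ← this]
    simp only [Function.comp_apply, LinearIsometryEquiv.symm_apply_apply, zOf_eq_repr_symm, e]
  have hd := hL.comp x e.toContinuousLinearEquiv.hasFDerivAt
  have h1 : e e1 = 1 := by
    rw [← zOf_eq_repr_symm]; simp [zOf, e1, mk2]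
  have h2 : e e2 = I := by
    rw [← zOf_eq_repr_symm]; simp [zOf, e2, mk2]
  have hf : fderiv ℝ ((fun z => ∫ w, (g ∘ e.symm) w / (z - w)) ∘ e) x = _ := hd.fderiv
  rw [hint, pdv, pdv, hf]
  simpa [h1, h2] using hLe

section MatrixRegularity

variable {𝕜 E : Type*} [NontriviallyNormedField 𝕜] [NormedAlgebra 𝕜 ℂ] [NormedAddCommGroup E]
  [NormedSpace 𝕜 E] {m : ℕ} {n : WithTop ℕ∞} {S : Set E} {A : E → Mat m}

lemma contDiffOn_det (hA : ∀ i j, ContDiffOn 𝕜 n (fun x => A x i j) S) :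
    ContDiffOn 𝕜 n (fun x => (A x).det) S := by
  simp only [Matrix.det_apply, Units.smul_def, zsmul_eq_mul]
  exact ContDiffOn.sum fun σ _ => contDiffOn_const.mul (contDiffOn_prod fun i _ => hA _ _)

lemma contDiffOn_inv_entry (hA : ∀ i j, ContDiffOn 𝕜 n (fun x => A x i j) S)
    (hdet : ∀ x ∈ S, (A x).det ≠ 0) (i j : Fin m) :
    ContDiffOn 𝕜 n (fun x => (A x)⁻¹ i j) S := by
  simp only [Matrix.inv_def, Ring.inverse_eq_inv', Matrix.smul_apply, smul_eq_mul,
    Matrix.adjugate_apply]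
  refine ((contDiffOn_det hA).inv hdet).mul (contDiffOn_det fun k l => ?_)
  by_cases hk : k = j
  · subst hk
    simpa using contDiffOn_const
  · simpa [Matrix.updateRow_ne hk] using hA k l

lemma contDiffOn_inv_mulVec {v : E → Vec m} (hA : ∀ i j, ContDiffOn 𝕜 n (fun x => A x i j) S)
    (hdet : ∀ x ∈ S, (A x).det ≠ 0) (hv : ∀ j, ContDiffOn 𝕜 n (fun x => v x j) S) (i : Fin m) :
    ContDiffOn 𝕜 n (fun x => ((A x)⁻¹ *ᵥ v x) i) S := by
  simp only [Matrix.mulVec, dotProduct]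
  exact ContDiffOn.sum fun j _ => (contDiffOn_inv_entry hA hdet i j).mul (hv j)

end MatrixRegularity

lemma circleIntegral_mean {P : ℂ → ℂ} (hP : DifferentiableOn ℂ P (Metric.ball 0 1)) {r : ℝ}
    (hr0 : 0 < r) (hr1 : r < 1) :
    ∫ φ in (0 : ℝ)..(2 * Real.pi), P (circleMap 0 r φ) = 2 * Real.pi * P 0 := by
  have h : DiffContOnCl ℂ P (Metric.ball 0 |r|) := by
    refine (hP.mono ?_).diffContOnCl_ball (U := Metric.closedBall 0 r) ?_
    · exact Metric.closedBall_subset_ball hr1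
    · rw [abs_of_pos hr0]
  have := h.circleAverage
  rw [Real.circleAverage_def, real_smul, ofReal_inv, inv_mul_eq_iff_eq_mul₀] at this
  · rw [this]; push_cast; ring
  · exact_mod_cast Real.two_pi_pos.ne'

/-- Averaging a weakly singular integral over a circle on which the integrand is analytic. -/
lemma circle_mean_singular {R r : ℝ} (hr0 : 0 < r) (hr1 : r < 1) (x : R2) {b : R2 → ℂ → ℂ}
    {K : ℂ → R2 → ℂ} {M : ℝ}
    (hb : ContinuousOn (fun p : R2 × ℝ => b p.1 (circleMap 0 r p.2))
      (Metric.closedBall 0 R ×ˢ Set.univ))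
    (hb0 : ∀ y, R ≤ ‖y‖ → ∀ s, b y s = 0)
    (hbd : ∀ y, ‖y‖ < R → DifferentiableOn ℂ (b y) (Metric.ball 0 1))
    (hKm : Measurable (fun p : R2 × ℝ => K (circleMap 0 r p.2) p.1))
    (hKb : ∀ y φ, ‖K (circleMap 0 r φ) y‖ ≤ M * ‖x - y‖⁻¹)
    (hKd : ∀ y, y ≠ x → DifferentiableOn ℂ (fun s => K s y) (Metric.ball 0 1)) :
    IntervalIntegrable (fun φ => ∫ y, b y (circleMap 0 r φ) * K (circleMap 0 r φ) y)
      volume 0 (2 * Real.pi) ∧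
    ∫ φ in (0 : ℝ)..(2 * Real.pi), ∫ y, b y (circleMap 0 r φ) * K (circleMap 0 r φ) y =
      2 * Real.pi * ∫ y, b y 0 * K 0 y := by
  have hpi : (0 : ℝ) ≤ 2 * Real.pi := Real.two_pi_pos.le
  obtain ⟨B, hB⟩ := ((isCompact_closedBall (0 : R2) R).prod
    (isCompact_Icc (a := (0 : ℝ)) (b := 2 * Real.pi))).exists_bound_of_continuousOn
    (hb.mono (Set.prod_mono le_rfl (Set.subset_univ _)))
  have hM : ∀ y φ, 0 ≤ M * ‖x - y‖⁻¹ := fun y φ => (norm_nonneg _).trans (hKb y φ)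
  let F : ℝ × R2 → ℂ := fun p => b p.2 (circleMap 0 r p.1) * K (circleMap 0 r p.1) p.2
  let μ : Measure ℝ := volume.restrict (Set.Ioc 0 (2 * Real.pi))
  have hFm : AEStronglyMeasurable F (μ.prod volume) := by
    have h1 : ContinuousOn (fun p : ℝ × R2 => b p.2 (circleMap 0 r p.1))
        (Set.univ ×ˢ Metric.closedBall 0 R) :=
      hb.comp (t := Metric.closedBall 0 R ×ˢ Set.univ) continuous_swap.continuousOn
        fun p hp => ⟨hp.2, trivial⟩
    have hms : MeasurableSet ((Set.univ : Set ℝ) ×ˢ Metric.closedBall (0 : R2) R) :=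
      MeasurableSet.univ.prod Metric.isClosed_closedBall.measurableSet
    have h2 := (aestronglyMeasurable_indicator_iff (μ := μ.prod (volume : Measure R2)) hms).2
      (h1.aestronglyMeasurable hms)
    have h3 : Set.indicator ((Set.univ : Set ℝ) ×ˢ Metric.closedBall (0 : R2) R)
        (fun p : ℝ × R2 => b p.2 (circleMap 0 r p.1)) = fun p => b p.2 (circleMap 0 r p.1) := by
      refine Set.indicator_eq_self.2 fun p hp => ⟨trivial, ?_⟩
      rw [mem_closedBall_zero_iff]
      by_contra hlt
      exact hp (hb0 _ (not_le.1 hlt).le _)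
    rw [h3] at h2
    exact h2.mul (hKm.comp measurable_swap).aestronglyMeasurable
  have hdom : Integrable (fun p : ℝ × R2 =>
      (1 : ℝ) * Set.indicator (Metric.closedBall (0 : R2) R) (fun y => B * (M * ‖x - y‖⁻¹)) p.2)
      (μ.prod volume) := by
    refine Integrable.mul_prod (f := fun _ : ℝ => (1 : ℝ)) (g := Set.indicator
      (Metric.closedBall (0 : R2) R) (fun y => B * (M * ‖x - y‖⁻¹))) (integrable_const _) ?_
    rw [integrable_indicator_iff Metric.isClosed_closedBall.measurableSet]
    have h0 := locallyIntegrable_inv_norm (volume : Measure R2) (by simp)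
    have h1 : LocallyIntegrable (fun y : R2 => ‖x - y‖⁻¹) := by
      rw [locallyIntegrable_iff] at h0 ⊢
      intro k hk
      have := h0 ((fun y => x - y) '' k) (hk.image (by fun_prop))
      rw [← (Measure.measurePreserving_sub_left (volume : Measure R2) x).integrableOn_comp_preimage
        (Homeomorph.subLeft x).measurableEmbedding] at this
      refine this.mono_set (Set.subset_preimage_image _ _)
    exact ((h1.integrableOn_isCompact (isCompact_closedBall _ _)).const_mul M).const_mul B
  have hFi : Integrable F (μ.prod volume) := by
    refine hdom.mono' hFm ?_
    have : ∀ᵐ p ∂(μ.prod (volume : Measure R2)), p.1 ∈ Set.Ioc 0 (2 * Real.pi) :=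
      Measure.quasiMeasurePreserving_fst.ae (ae_restrict_mem measurableSet_Ioc)
    filter_upwards [this] with p hp
    rw [one_mul]
    by_cases hpR : p.2 ∈ Metric.closedBall (0 : R2) R
    · rw [Set.indicator_of_mem hpR, norm_mul]
      have := hB (p.2, p.1) ⟨hpR, hp.1.le, hp.2⟩
      exact mul_le_mul this (hKb _ _) (norm_nonneg _) ((norm_nonneg _).trans this)
    · rw [Set.indicator_of_notMem hpR]
      rw [mem_closedBall_zero_iff, not_le] at hpR
      simp [F, hb0 _ hpR.le]
  refine ⟨?_, ?_⟩
  · rw [intervalIntegrable_iff_integrableOn_Ioc_of_le hpi]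
    exact hFi.integral_prod_left
  · rw [intervalIntegral.integral_of_le hpi]
    rw [integral_integral_swap (f := fun φ y => F (φ, y)) hFi, ← integral_const_mul]
    refine integral_congr_ae ?_
    filter_upwards [Measure.ae_ne volume x] with y hy
    rw [← intervalIntegral.integral_of_le hpi]
    by_cases hyR : ‖y‖ < R
    · exact circleIntegral_mean ((hbd y hyR).mul (hKd y hy)) hr0 hr1
    · simp [F, hb0 y (not_lt.1 hyR)]

lemma contDiffOn_intervalIntegral {U : Set R2} (hU : IsOpen U) {F : R2 × ℝ → ℂ}
    (hF : ContDiffOn ℝ 1 F (U ×ˢ Set.univ)) (a b : ℝ) :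
    ContDiffOn ℝ 1 (fun x => ∫ φ in a..b, F (x, φ)) U := by
  have hUo : IsOpen (U ×ˢ (Set.univ : Set ℝ)) := hU.prod isOpen_univ
  let F' : R2 × ℝ → R2 →L[ℝ] ℂ := fun p => (fderiv ℝ F p).comp (ContinuousLinearMap.inl ℝ R2 ℝ)
  have hF'c : ContinuousOn F' (U ×ˢ Set.univ) :=
    (hF.continuousOn_fderiv_of_isOpen hUo le_rfl).clm_comp continuousOn_const
  have hsec : ∀ x ∈ U, Continuous fun φ : ℝ => F (x, φ) := fun x hx =>
    hF.continuousOn.comp_continuous (by fun_prop) fun φ => ⟨hx, trivial⟩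
  have hsec' : ∀ x ∈ U, Continuous fun φ : ℝ => F' (x, φ) := fun x hx =>
    hF'c.comp_continuous (by fun_prop) fun φ => ⟨hx, trivial⟩
  have hbound : ∀ x₀ ∈ U, ∃ s ∈ 𝓝 x₀, s ⊆ U ∧ ∃ B : ℝ,
      ∀ φ ∈ Set.uIoc a b, ∀ x ∈ s, ‖F' (x, φ)‖ ≤ B := fun x₀ hx₀ => by
    obtain ⟨ε, hε, hsub⟩ := Metric.nhds_basis_closedBall.mem_iff.1 (hU.mem_nhds hx₀)
    obtain ⟨B, hB⟩ := ((isCompact_closedBall x₀ ε).prod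
      (isCompact_uIcc (a := a) (b := b))).exists_bound_of_continuousOn
      (hF'c.mono (Set.prod_mono hsub (Set.subset_univ _)))
    exact ⟨_, Metric.closedBall_mem_nhds x₀ hε, hsub, B,
      fun φ hφ x hx => hB (x, φ) ⟨hx, Set.uIoc_subset_uIcc hφ⟩⟩
  have hder : ∀ x₀ ∈ U, HasFDerivAt (fun x => ∫ φ in a..b, F (x, φ))
      (∫ φ in a..b, F' (x₀, φ)) x₀ := fun x₀ hx₀ => by
    obtain ⟨s, hs, hsU, B, hB⟩ := hbound x₀ hx₀
    refine intervalIntegral.hasFDerivAt_integral_of_dominated_of_fderiv_le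
      (F := fun x φ => F (x, φ)) (F' := fun x φ => F' (x, φ)) (bound := fun _ => B) hs ?_
      ((hsec x₀ hx₀).intervalIntegrable _ _) (hsec' x₀ hx₀).aestronglyMeasurable
      (Eventually.of_forall hB) intervalIntegrable_const
      (Eventually.of_forall fun φ _ x hx => ?_)
    · filter_upwards [hs] with x hx using (hsec x (hsU hx)).aestronglyMeasurable
    · have h1 : HasFDerivAt F (fderiv ℝ F (x, φ)) (x, φ) :=
        ((hF.contDiffAt (hUo.mem_nhds ⟨hsU hx, trivial⟩)).differentiableAt one_ne_zero).hasFDerivAt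
      exact h1.comp x (hasFDerivAt_prodMk_left x φ)
  rw [show (1 : WithTop ℕ∞) = 0 + 1 from (zero_add 1).symm,
    contDiffOn_succ_iff_fderiv_of_isOpen hU]
  refine ⟨fun x hx => (hder x hx).differentiableAt.differentiableWithinAt, by simp, ?_⟩
  rw [contDiffOn_zero]
  refine ContinuousOn.congr (f := fun x => ∫ φ in a..b, F' (x, φ)) (fun x₀ hx₀ => ?_)
    fun x hx => (hder x hx).fderiv
  obtain ⟨s, hs, hsU, B, hB⟩ := hbound x₀ hx₀
  refine ContinuousAt.continuousWithinAt ?_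
  refine intervalIntegral.continuousAt_of_dominated_interval (bound := fun _ => B) ?_ ?_
    intervalIntegrable_const (Eventually.of_forall fun φ _ => ?_)
  · filter_upwards [hs] with x hx using (hsec' x (hsU hx)).aestronglyMeasurable
  · filter_upwards [hs] with x hx using Eventually.of_forall fun φ hφ => hB φ hφ x hx
  · exact (hF'c.continuousAt (hUo.mem_nhds ⟨hx₀, trivial⟩)).comp
      (f := fun x => (x, φ)) (by fun_prop)

lemma circle_mean_conj {m : ℕ} {R r : ℝ} (hr0 : 0 < r) (hr1 : r < 1) {x : R2}
    (hx : ‖x‖ < 2 * R) {C : R2 → ℂ → Mat m} {f : R2 → Vec m} {K : ℂ → R2 → ℂ} {M : ℝ}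
    (hC : ∀ i j, ContinuousOn (fun p : R2 × ℂ => C p.1 p.2 i j)
      (Metric.closedBall 0 (2 * R) ×ˢ Metric.sphere 0 r))
    (hCd : ∀ y, ‖y‖ ≤ 2 * R → ∀ i j, DifferentiableOn ℂ (fun s => C y s i j) (Metric.ball 0 1))
    (hdet : ∀ y, ‖y‖ ≤ 2 * R → ∀ s ∈ Metric.ball (0 : ℂ) 1, (C y s).det ≠ 0)
    (hf : ∀ j, Continuous fun y => f y j) (hf0 : ∀ y, R ≤ ‖y‖ → f y = 0)
    (hKm : Measurable (fun p : R2 × ℝ => K (circleMap 0 r p.2) p.1))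
    (hKb : ∀ y φ, ‖K (circleMap 0 r φ) y‖ ≤ M * ‖x - y‖⁻¹)
    (hKd : ∀ y, y ≠ x → DifferentiableOn ℂ (fun s => K s y) (Metric.ball 0 1)) (i : Fin m) :
    ∫ φ in (0 : ℝ)..(2 * Real.pi), (C x (circleMap 0 r φ) *ᵥ fun j =>
        ∫ y, ((C y (circleMap 0 r φ))⁻¹ *ᵥ f y) j * K (circleMap 0 r φ) y) i =
      2 * Real.pi * (C x 0 *ᵥ fun j => ∫ y, ((C y 0)⁻¹ *ᵥ f y) j * K 0 y) i := by
  have hR : 0 < R := by linarith [norm_nonneg x]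
  have hcirc : ∀ φ : ℝ, circleMap 0 r φ ∈ Metric.sphere (0 : ℂ) r := fun φ =>
    circleMap_mem_sphere _ hr0.le _
  have hopen : IsOpen (Metric.ball (0 : ℂ) 1) := Metric.isOpen_ball
  have key := fun j : Fin m => circle_mean_singular (R := R) hr0 hr1 x
    (b := fun y s => C x s i j * ((C y s)⁻¹ *ᵥ f y) j) (K := K) (M := M) ?_ ?_ ?_ hKm hKb hKd
  · simp only [Matrix.mulVec, dotProduct, ← integral_const_mul] at key ⊢
    simp only [mul_assoc] at key ⊢
    rw [intervalIntegral.integral_finsetSum fun j _ => (key j).1, Finset.mul_sum, Finset.mul_sum]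
    refine Finset.sum_congr rfl fun j _ => ?_
    rw [(key j).2]
    simp only [integral_const_mul]
  · have hCc : ∀ k l, ContinuousOn (fun p : R2 × ℝ => C p.1 (circleMap 0 r p.2) k l)
        (Metric.closedBall 0 R ×ˢ Set.univ) := fun k l =>
      (hC k l).comp (f := fun p : R2 × ℝ => (p.1, circleMap 0 r p.2))
        (by fun_prop) fun p hp =>
        ⟨Metric.closedBall_subset_closedBall (by linarith) hp.1, hcirc p.2⟩
    refine ContinuousOn.mul ?_ ?_
    · exact (hC i j).comp (f := fun p : R2 × ℝ => (x, circleMap 0 r p.2))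
        (by fun_prop) fun p _ => ⟨mem_closedBall_zero_iff.2 hx.le, hcirc p.2⟩
    · refine (contDiffOn_inv_mulVec (𝕜 := ℝ) (n := 0)
        (A := fun p : R2 × ℝ => C p.1 (circleMap 0 r p.2)) (v := fun p => f p.1)
        (fun k l => contDiffOn_zero.2 (hCc k l)) (fun p hp => hdet _ ?_ _ ?_)
        (fun k => contDiffOn_zero.2 ((hf k).comp continuous_fst).continuousOn) j).continuousOn
      · have := mem_closedBall_zero_iff.1 hp.1
        linarith
      · simpa [abs_of_pos hr0] using hr1
  · intro y hy s
    simp [hf0 y hy]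
  · intro y hy
    have hy2 : ‖y‖ ≤ 2 * R := by linarith
    exact (hCd x hx.le i j).mul ((contDiffOn_inv_mulVec (𝕜 := ℂ) (n := 1)
      (A := fun s => C y s) (v := fun _ => f y) (fun k l => (hCd y hy2 k l).contDiffOn hopen)
      (hdet y hy2) (fun _ => contDiffOn_const) j).differentiableOn one_ne_zero)

lemma one_sub_sq_mul_le {s w : ℂ} :
    (1 - ‖s‖ ^ 2) * ‖w‖ ≤ ‖w + s ^ 2 * (starRingEnd ℂ) w‖ := by
  have h := norm_sub_le (w + s ^ 2 * (starRingEnd ℂ) w) (s ^ 2 * (starRingEnd ℂ) w)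
  rw [add_sub_cancel_right, norm_mul, norm_pow, RCLike.norm_conj] at h
  linarith

lemma one_sub_sq_mul_le' {s w : ℂ} :
    (1 - ‖s‖ ^ 2) * ‖w‖ ≤ ‖s ^ 2 * w + (starRingEnd ℂ) w‖ := by
  have h := one_sub_sq_mul_le (s := s) (w := (starRingEnd ℂ) w)
  rwa [RCLike.norm_conj, RCLike.conj_conj, add_comm] at h

lemma integral_comp_neg_circle {P : ℂ → ℂ} (r : ℝ) :
    ∫ φ in (0 : ℝ)..(2 * Real.pi), P (circleMap 0 r (-φ)) =
      ∫ φ in (0 : ℝ)..(2 * Real.pi), P (circleMap 0 r φ) := by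
  rw [intervalIntegral.integral_comp_neg (fun φ => P (circleMap 0 r φ))]
  have hper : Function.Periodic (fun φ => P (circleMap 0 r φ)) (2 * Real.pi) := fun φ => by
    simp only [periodic_circleMap 0 r φ]
  simpa using hper.intervalIntegral_add_eq (-(2 * Real.pi)) 0

lemma norm_sq_lt_one {s : ℂ} (hs : ‖s‖ < 1) : 0 < 1 - ‖s‖ ^ 2 := by
  nlinarith [norm_nonneg s]

lemma mulVec_PiTV_mul {m : ℕ} (A : Mat m) (g : R2 → Vec m) {t : ℂ} {x : R2} {k : R2 → ℂ}
    (hk : ∀ y, k y = t / ker t x y) (i : Fin m) :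
    (A *ᵥ PiTV t g x) i * (I * t) =
      (I * (Real.pi : ℂ)⁻¹) * (A *ᵥ fun j => ∫ y, g y j * k y) i := by
  simp only [Matrix.mulVec, dotProduct, PiTV, Finset.sum_mul, Finset.mul_sum, hk]
  refine Finset.sum_congr rfl fun j _ => ?_
  have h : ∫ y, g y j * (t / ker t x y) = t * ∫ y, g y j / ker t x y := by
    rw [← integral_const_mul]
    exact integral_congr_ae (Eventually.of_forall fun y => by simp only; ring)
  rw [h]
  ring

/-- The contour integral of `u₋` vanishes. -/
lemma circIntV_interior {m : ℕ} {R : ℝ} {c : R2 → ℂ → Mat m} {f : R2 → Vec m} {ρ : ℝ}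
    (hρ0 : 0 < ρ) (hρ1 : ρ < 1) {x : R2} (hx : ‖x‖ < 2 * R)
    (hC : ∀ i j, ContinuousOn (fun p : R2 × ℂ => c p.1 p.2 i j)
      {p : R2 × ℂ | ‖p.1‖ ≤ 2 * R ∧ ‖p.2‖ ≤ 1})
    (hCd : ∀ y, ‖y‖ ≤ 2 * R → ∀ i j, DifferentiableOn ℂ (fun s => c y s i j) {t : ℂ | ‖t‖ < 1})
    (hdet : ∀ y s, ‖y‖ ≤ 2 * R → ‖s‖ ≤ 1 → (c y s).det ≠ 0)
    (hf : ∀ j, Continuous fun y => f y j) (hf0 : ∀ y, R ≤ ‖y‖ → f y = 0) :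
    circIntV (fun t => c x t *ᵥ PiTV t (fun y => (c y t)⁻¹ *ᵥ f y) x) ρ = 0 := by
  funext i
  have hball : Metric.ball (0 : ℂ) 1 = {t : ℂ | ‖t‖ < 1} := by ext; simp
  let K : ℂ → R2 → ℂ := fun s y =>
    s ^ 2 / (s ^ 2 * (zOf x - zOf y) + (starRingEnd ℂ) (zOf x - zOf y))
  have hz := continuous_zOf
  have key := circle_mean_conj (K := K) (M := ρ ^ 2 * (1 - ρ ^ 2)⁻¹) (f := f) hρ0 hρ1 hx
    (fun i j => (hC i j).mono fun p hp => ⟨mem_closedBall_zero_iff.1 hp.1, by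
      rw [mem_sphere_zero_iff_norm.1 hp.2]; exact hρ1.le⟩)
    (fun y hy i j => hball ▸ hCd y hy i j)
    (fun y hy s hs => hdet y s hy (mem_ball_zero_iff.1 hs).le) hf hf0 ?_ ?_ ?_ i
  · have h0 : ∀ y, K 0 y = 0 := fun y => by simp [K]
    simp only [h0, mul_zero, integral_zero] at key
    rw [show (fun _ : Fin m => (0 : ℂ)) = 0 from rfl, Matrix.mulVec_zero, Pi.zero_apply,
      mul_zero] at key
    have hfun : ∀ φ : ℝ,
        (c x (ρ * exp (I * φ)) *ᵥ PiTV (ρ * exp (I * φ))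
          (fun y => (c y (ρ * exp (I * φ)))⁻¹ *ᵥ f y) x) i * (I * ρ * exp (I * φ)) =
        (I * (Real.pi : ℂ)⁻¹) * (c x (circleMap 0 ρ φ) *ᵥ fun j =>
          ∫ y, ((c y (circleMap 0 ρ φ))⁻¹ *ᵥ f y) j * K (circleMap 0 ρ φ) y) i := fun φ => by
      have ht : (ρ : ℂ) * exp (I * φ) = circleMap 0 ρ φ := by rw [circleMap_zero, mul_comm I]
      have ht0 : circleMap 0 ρ φ ≠ 0 := circleMap_ne_center hρ0.ne'
      rw [mul_assoc I, ht]
      refine mulVec_PiTV_mul _ _ (fun y => ?_) i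
      have h2 : circleMap 0 ρ φ ^ 2 * (zOf x - zOf y) + (starRingEnd ℂ) (zOf x - zOf y) =
          circleMap 0 ρ φ * ker (circleMap 0 ρ φ) x y := by
        rw [_root_.ker]; field_simp
      simp only [K]
      rw [h2, pow_two, mul_div_mul_left _ _ ht0]
    simp only [circIntV, hfun, intervalIntegral.integral_const_mul, key, mul_zero, Pi.zero_apply]
  · refine Measurable.div (by fun_prop) (Continuous.measurable ?_)
    have := Complex.continuous_conj
    fun_prop
  · intro y φ
    have hs : ‖circleMap 0 ρ φ‖ = ρ := by simp [abs_of_pos hρ0]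
    have h1 := one_sub_sq_mul_le' (s := circleMap 0 ρ φ) (w := zOf x - zOf y)
    have h2 := norm_sq_lt_one (s := circleMap 0 ρ φ) (by rwa [hs])
    rw [hs, norm_zOf_sub] at h1
    rw [hs] at h2
    simp only [K]
    rw [norm_div, norm_pow, hs]
    rcases eq_or_ne y x with rfl | hne
    · simp
    · have h3 : 0 < ‖x - y‖ := norm_pos_iff.2 (sub_ne_zero.2 hne.symm)
      rw [mul_assoc, ← mul_inv, div_eq_mul_inv]
      gcongr
  · intro y hne
    refine DifferentiableOn.div (by fun_prop) (by fun_prop) fun s hs => ?_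
    rw [← norm_pos_iff]
    refine lt_of_lt_of_le ?_ one_sub_sq_mul_le'
    exact mul_pos (norm_sq_lt_one (mem_ball_zero_iff.1 hs)) (norm_pos_iff.2 (zOf_sub_ne_zero hne))

section Infinity

variable {m : ℕ} {F : ℂ → Mat m} {L : Mat m}

lemma extInf_of_ne_zero {s : ℂ} (hs : s ≠ 0) : extInf F L s = F s⁻¹ := if_neg hs

lemma extInf_zero : extInf F L 0 = L := if_pos rfl

lemma one_lt_norm_inv {s : ℂ} (hs : s ≠ 0) (h1 : ‖s‖ < 1) : 1 < ‖s⁻¹‖ := by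
  rw [norm_inv]
  exact (one_lt_inv₀ (norm_pos_iff.2 hs)).2 h1

lemma differentiableOn_extInf {i j : Fin m}
    (hF : DifferentiableOn ℂ (fun t => F t i j) {t : ℂ | 1 < ‖t‖})
    (h0 : AnalyticAt ℂ (fun s => extInf F L s i j) 0) :
    DifferentiableOn ℂ (fun s => extInf F L s i j) (Metric.ball 0 1) := by
  intro s hs
  refine DifferentiableAt.differentiableWithinAt ?_
  rcases eq_or_ne s 0 with rfl | hne
  · exact h0.differentiableAt
  · have hopen : IsOpen {t : ℂ | 1 < ‖t‖} := isOpen_lt continuous_const continuous_norm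
    have h1 := (hF.differentiableAt
      (hopen.mem_nhds (one_lt_norm_inv hne (mem_ball_zero_iff.1 hs)))).comp s
      (differentiableAt_inv hne)
    refine h1.congr_of_eventuallyEq ?_
    filter_upwards [isOpen_ne.mem_nhds hne] with w hw
    simp only [extInf_of_ne_zero hw, Function.comp_apply]

lemma det_extInf_ne_zero (hF : ∀ t, 1 ≤ ‖t‖ → (F t).det ≠ 0) (hL : L.det ≠ 0) {s : ℂ}
    (hs : ‖s‖ < 1) : (extInf F L s).det ≠ 0 := by
  rcases eq_or_ne s 0 with rfl | hne
  · rwa [extInf_zero]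
  · rw [extInf_of_ne_zero hne]
    exact hF _ (one_lt_norm_inv hne hs).le

end Infinity

/-- The contour integral of `u₊` is a conjugated Cauchy transform of `f`. -/
lemma circIntV_exterior {m : ℕ} {R : ℝ} {c : R2 → ℂ → Mat m} {cinf : R2 → Mat m}
    {f : R2 → Vec m} {ρ : ℝ} (hρ : 1 < ρ) {x : R2} (hx : ‖x‖ < 2 * R)
    (hC : ∀ i j, ContinuousOn (fun p : R2 × ℂ => c p.1 p.2 i j)
      {p : R2 × ℂ | ‖p.1‖ ≤ 2 * R ∧ 1 ≤ ‖p.2‖})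
    (hCd : ∀ y, ‖y‖ ≤ 2 * R → ∀ i j,
      DifferentiableOn ℂ (fun s => c y s i j) {t : ℂ | 1 < ‖t‖} ∧
      AnalyticAt ℂ (fun s => extInf (c y) (cinf y) s i j) 0)
    (hdet : ∀ y s, ‖y‖ ≤ 2 * R → 1 ≤ ‖s‖ → (c y s).det ≠ 0)
    (hdinf : ∀ y, ‖y‖ ≤ 2 * R → (cinf y).det ≠ 0)
    (hf : ∀ j, Continuous fun y => f y j) (hf0 : ∀ y, R ≤ ‖y‖ → f y = 0) :
    circIntV (fun t => c x t *ᵥ PiTV t (fun y => (c y t)⁻¹ *ᵥ f y) x) ρ =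
      (2 * Real.pi * I : ℂ) • (cinf x *ᵥ CauchyV (fun y => (cinf y)⁻¹ *ᵥ f y) x) := by
  funext i
  have hρ0 : 0 < ρ := one_pos.trans hρ
  have hr0 : 0 < ρ⁻¹ := inv_pos.2 hρ0
  have hr1 : ρ⁻¹ < 1 := inv_lt_one_of_one_lt₀ hρ
  let K : ℂ → R2 → ℂ := fun s y =>
    1 / ((zOf x - zOf y) + s ^ 2 * (starRingEnd ℂ) (zOf x - zOf y))
  have hz := continuous_zOf
  have key := circle_mean_conj (C := fun y s => extInf (c y) (cinf y) s) (K := K)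
    (M := (1 - ρ⁻¹ ^ 2)⁻¹) (f := f) hr0 hr1 hx ?_
    (fun y hy i j => differentiableOn_extInf (hCd y hy i j).1 (hCd y hy i j).2)
    (fun y hy s hs => det_extInf_ne_zero (fun t ht => hdet y t hy ht) (hdinf y hy)
      (mem_ball_zero_iff.1 hs)) hf hf0 ?_ ?_ ?_ i
  · have hfun : ∀ φ : ℝ,
        (c x (ρ * exp (I * φ)) *ᵥ PiTV (ρ * exp (I * φ))
          (fun y => (c y (ρ * exp (I * φ)))⁻¹ *ᵥ f y) x) i * (I * ρ * exp (I * φ)) =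
        (I * (Real.pi : ℂ)⁻¹) * (fun s => (extInf (c x) (cinf x) s *ᵥ fun j =>
          ∫ y, ((extInf (c y) (cinf y) s)⁻¹ *ᵥ f y) j * K s y) i)
            (circleMap 0 ρ⁻¹ (-φ)) := fun φ => by
      have ht : (ρ : ℂ) * exp (I * φ) = (circleMap 0 ρ⁻¹ (-φ))⁻¹ := by
        rw [circleMap_zero, mul_inv, ← Complex.exp_neg]
        push_cast
        rw [inv_inv, neg_mul, neg_neg, mul_comm I]
      have hs0 : circleMap 0 ρ⁻¹ (-φ) ≠ 0 := circleMap_ne_center hr0.ne'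
      rw [mul_assoc I, ht]
      simp only [extInf_of_ne_zero hs0]
      refine mulVec_PiTV_mul _ _ (fun y => ?_) i
      generalize circleMap 0 ρ⁻¹ (-φ) = s at hs0
      have h2 : ker s⁻¹ x y =
          s⁻¹ * ((zOf x - zOf y) + s ^ 2 * (starRingEnd ℂ) (zOf x - zOf y)) := by
        rw [_root_.ker]; field_simp
      simp only [K]
      rw [h2, div_mul_cancel_left₀ (inv_ne_zero hs0), one_div]
    simp only [circIntV, hfun, intervalIntegral.integral_const_mul]
    rw [integral_comp_neg_circle (P := fun s => (extInf (c x) (cinf x) s *ᵥ fun j =>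
          ∫ y, ((extInf (c y) (cinf y) s)⁻¹ *ᵥ f y) j * K s y) i), key]
    simp only [extInf_zero, K, CauchyV, Pi.smul_apply, smul_eq_mul, Matrix.mulVec, dotProduct,
      Finset.mul_sum]
    refine Finset.sum_congr rfl fun j _ => ?_
    simp only [ne_eq, OfNat.ofNat_ne_zero, not_false_eq_true, zero_pow, zero_mul, add_zero,
      mul_one_div]
    ring
  · intro i j
    have h1 : ContinuousOn (fun p : R2 × ℂ => c p.1 p.2⁻¹ i j)
        (Metric.closedBall 0 (2 * R) ×ˢ Metric.sphere 0 ρ⁻¹) := by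
      refine (hC i j).comp (f := fun p : R2 × ℂ => (p.1, p.2⁻¹)) ?_ fun p hp =>
        ⟨mem_closedBall_zero_iff.1 hp.1, ?_⟩
      · refine continuousOn_fst.prodMk (continuousOn_snd.inv₀ fun p hp => ?_)
        exact Metric.ne_of_mem_sphere hp.2 hr0.ne'
      · rw [norm_inv, mem_sphere_zero_iff_norm.1 hp.2, inv_inv]
        exact hρ.le
    refine h1.congr fun p hp => ?_
    simp only [extInf_of_ne_zero (Metric.ne_of_mem_sphere hp.2 hr0.ne')]
  · refine Measurable.div (by fun_prop) (Continuous.measurable ?_)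
    have := Complex.continuous_conj
    fun_prop
  · intro y φ
    have hs : ‖circleMap 0 ρ⁻¹ φ‖ = ρ⁻¹ := by simp [abs_of_pos hρ0]
    have h1 := one_sub_sq_mul_le (s := circleMap 0 ρ⁻¹ φ) (w := zOf x - zOf y)
    have h2 := norm_sq_lt_one (s := circleMap 0 ρ⁻¹ φ) (by rwa [hs])
    rw [hs, norm_zOf_sub] at h1
    rw [hs] at h2
    simp only [K]
    rw [norm_div, norm_one, one_div]
    rcases eq_or_ne y x with rfl | hne
    · simp
    · have h3 : 0 < ‖x - y‖ := norm_pos_iff.2 (sub_ne_zero.2 hne.symm)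
      rw [← mul_inv]
      gcongr
  · intro y hne
    refine DifferentiableOn.div (by fun_prop) (by fun_prop) fun s hs => ?_
    rw [← norm_pos_iff]
    refine lt_of_lt_of_le ?_ one_sub_sq_mul_le
    exact mul_pos (norm_sq_lt_one (mem_ball_zero_iff.1 hs)) (norm_pos_iff.2 (zOf_sub_ne_zero hne))

/-- The value at `t = ∞` inherits regularity in `x` through the mean value formula. -/
lemma contDiffOn_infinity {m : ℕ} {R : ℝ} {c : R2 → ℂ → Mat m} {cinf : R2 → Mat m}
    {i j : Fin m}
    (hC : ContDiffOn ℝ 1 (fun p : R2 × ℂ => c p.1 p.2 i j)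
      {p : R2 × ℂ | ‖p.1‖ ≤ 2 * R ∧ 1 ≤ ‖p.2‖})
    (hCd : ∀ y, ‖y‖ ≤ 2 * R →
      DifferentiableOn ℂ (fun s => c y s i j) {t : ℂ | 1 < ‖t‖} ∧
      AnalyticAt ℂ (fun s => extInf (c y) (cinf y) s i j) 0) :
    ContDiffOn ℝ 1 (fun y => cinf y i j) (Metric.ball 0 (2 * R)) := by
  have hne : ∀ φ : ℝ, circleMap 0 2⁻¹ φ ≠ 0 := fun φ => circleMap_ne_center (by norm_num)
  have h1 := contDiffOn_intervalIntegral (U := Metric.ball 0 (2 * R)) Metric.isOpen_ball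
    (F := fun p => c p.1 (circleMap 0 2⁻¹ p.2)⁻¹ i j) ?_ 0 (2 * Real.pi)
  · refine (contDiffOn_const (c := (2 * Real.pi : ℂ)⁻¹)).mul h1 |>.congr fun y hy => ?_
    have hy' := (mem_ball_zero_iff.1 hy).le
    have h2 := circleIntegral_mean (differentiableOn_extInf (hCd y hy').1 (hCd y hy').2)
      (r := 2⁻¹) (by norm_num) (by norm_num)
    simp only [extInf_zero, extInf_of_ne_zero (hne _)] at h2
    have hpi : (2 * Real.pi : ℂ) ≠ 0 := by exact_mod_cast Real.two_pi_pos.ne'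
    rw [h2, inv_mul_cancel_left₀ hpi]
  · refine hC.comp (f := fun p : R2 × ℝ => (p.1, (circleMap 0 2⁻¹ p.2)⁻¹)) ?_ fun p hp =>
      ⟨(mem_ball_zero_iff.1 hp.1).le, ?_⟩
    · have h3 : ContDiff ℝ 1 fun p : R2 × ℝ => circleMap 0 2⁻¹ p.2 :=
        (contDiff_circleMap 0 2⁻¹).comp contDiff_snd
      exact (contDiff_fst.prodMk (h3.inv fun p => hne _)).contDiffOn
    · exact (one_lt_norm_inv (hne _) (by simp; norm_num)).le

/-- The Cauchy transform is a right inverse of `∂/∂z̄`. -/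
lemma dzbarV_cauchyV {m : ℕ} {g : R2 → Vec m} (hg : ∀ i, ContDiff ℝ 1 fun y => g y i)
    (hc : ∀ i, HasCompactSupport fun y => g y i) (x : R2) : dzbarV (CauchyV g) x = g x := by
  funext i
  have h := dzbar_cauchy (g := fun y => (Real.pi : ℂ)⁻¹ * g y i) (contDiff_const.mul (hg i))
    ((hc i).mul_left) x
  simp only [mul_div_assoc, integral_const_mul] at h
  have hpi : (Real.pi : ℂ) ≠ 0 := by exact_mod_cast Real.pi_ne_zero
  simp only [dzbarV, CauchyV, h]
  field_simp

lemma dzbarV_congr {m : ℕ} {u v : R2 → Vec m} {x : R2} (h : u =ᶠ[𝓝 x] v) :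
    dzbarV u x = dzbarV v x := by
  funext i
  have hi : (fun y => u y i) =ᶠ[𝓝 x] fun y => v y i := h.mono fun y hy => congrFun hy i
  simp only [dzbarV, pdv, hi.fderiv_eq]

/-- Inversion of the attenuated non-abelian Radon transform (3.21). -/
theorem attenuated_inversion (m : ℕ) (hm : 1 ≤ m) (R : ℝ) (hR : 0 < R)
    (A : Fin 3 → R2 → Mat m)
    (hAsm : ∀ j, MatSmooth (A j)) (hAsupp : ∀ j, SuppIn (A j) R)
    (cp cm : R2 → ℂ → Mat m) (cpinf : R2 → Mat m)
    (heqp : ∀ x : R2, ‖x‖ ≤ 2*R → ∀ t : ℂ, 1 ≤ ‖t‖ →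
      zDirM (zeta1 t) (zeta2 t) (fun y => cp y t) x =
        Acomb (A 0) (A 1) (A 2) (zeta1 t) (zeta2 t) x * cp x t)
    (heqm : ∀ x : R2, ‖x‖ ≤ 2*R → ∀ t : ℂ, t ≠ 0 → ‖t‖ ≤ 1 →
      zDirM (zeta1 t) (zeta2 t) (fun y => cm y t) x =
        Acomb (A 0) (A 1) (A 2) (zeta1 t) (zeta2 t) x * cm x t)
    (hsmp : ∀ i j, ContDiffOn ℝ (⊤ : ℕ∞) (fun p : R2 × ℂ => cp p.1 p.2 i j)
      {p : R2 × ℂ | ‖p.1‖ ≤ 2*R ∧ 1 ≤ ‖p.2‖})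
    (hsmm : ∀ i j, ContDiffOn ℝ (⊤ : ℕ∞) (fun p : R2 × ℂ => cm p.1 p.2 i j)
      {p : R2 × ℂ | ‖p.1‖ ≤ 2*R ∧ ‖p.2‖ ≤ 1})
    (hdetp : ∀ (x : R2) (t : ℂ), ‖x‖ ≤ 2*R → 1 ≤ ‖t‖ → (cp x t).det ≠ 0)
    (hdetm : ∀ (x : R2) (t : ℂ), ‖x‖ ≤ 2*R → ‖t‖ ≤ 1 → (cm x t).det ≠ 0)
    (hanp : ∀ x : R2, ‖x‖ ≤ 2*R → ∀ i j,
      DifferentiableOn ℂ (fun t => cp x t i j) {t : ℂ | 1 < ‖t‖} ∧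
      AnalyticAt ℂ (fun s => extInf (cp x) (cpinf x) s i j) 0)
    (hanm : ∀ x : R2, ‖x‖ ≤ 2*R → ∀ i j,
      DifferentiableOn ℂ (fun t => cm x t i j) {t : ℂ | ‖t‖ < 1})
    (hdinf : ∀ x : R2, ‖x‖ ≤ 2*R → (cpinf x).det ≠ 0)
    (f : R2 → Vec m) (hfsm : ∀ i, ContDiff ℝ (⊤ : ℕ∞) (fun x => f x i))
    (hfsupp : ∀ x : R2, R ≤ ‖x‖ → f x = 0)
    (up um : R2 → ℂ → Vec m)
    (hup : ∀ (x : R2) (t : ℂ),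
      up x t = cp x t *ᵥ PiTV t (fun y => (cp y t)⁻¹ *ᵥ f y) x)
    (hum : ∀ (x : R2) (t : ℂ),
      um x t = cm x t *ᵥ PiTV t (fun y => (cm y t)⁻¹ *ᵥ f y) x) :
    -- (i) the contour integral of u₋ over |t|=ρ′ vanishes
    (∀ ρ' : ℝ, 0 < ρ' → ρ' < 1 → ∀ x : R2, ‖x‖ < 2*R →
      circIntV (fun t => um x t) ρ' = 0) ∧
    -- (ii) the inversion formula for the attenuated non-abelian Radon transform
    (∀ ρ : ℝ, 1 < ρ → ∀ x : R2, ‖x‖ < 2*R →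
      f x = cpinf x *ᵥ
        dzbarV (fun y => (cpinf y)⁻¹ *ᵥ
          ((2 * Real.pi * Complex.I : ℂ)⁻¹ • circIntV (fun t => up y t) ρ)) x) := by
  have hfc : ∀ j, Continuous fun y => f y j := fun j => (hfsm j).continuous
  simp only [hup, hum]
  refine ⟨fun ρ h0 h1 x hx => ?_, fun ρ hρ x hx => ?_⟩
  · exact circIntV_interior h0 h1 hx (fun i j => (hsmm i j).continuousOn) hanm hdetm hfc hfsupp
  let g : R2 → Vec m := fun y => (cpinf y)⁻¹ *ᵥ f y
  have hg0 : ∀ y, R ≤ ‖y‖ → g y = 0 := fun y hy => by simp only [g, hfsupp y hy, mulVec_zero]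
  have hg : ∀ i, ContDiff ℝ 1 fun y => g y i := fun i => by
    refine contDiff_iff_contDiffAt.2 fun y => ?_
    rcases lt_or_ge ‖y‖ (2 * R) with hy | hy
    · refine (contDiffOn_inv_mulVec (S := Metric.ball 0 (2 * R))
        (fun i j => contDiffOn_infinity ((hsmp i j).of_le (by exact_mod_cast le_top))
          fun y hy => hanp y hy i j)
        (fun y hy => hdinf y (mem_ball_zero_iff.1 hy).le)
        (fun j => ((hfsm j).of_le (by exact_mod_cast le_top)).contDiffOn) i).contDiffAt
        (Metric.isOpen_ball.mem_nhds (mem_ball_zero_iff.2 hy))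
    · refine contDiffAt_const (c := 0) |>.congr_of_eventuallyEq ?_
      filter_upwards [(isOpen_lt continuous_const continuous_norm).mem_nhds
        (show R < ‖y‖ by linarith)] with w hw
      rw [hg0 w (le_of_lt hw), Pi.zero_apply]
  have hgc : ∀ i, HasCompactSupport fun y => g y i := fun i =>
    HasCompactSupport.intro (isCompact_closedBall 0 R) fun y hy => by
      rw [mem_closedBall_zero_iff, not_le] at hy
      rw [hg0 y hy.le, Pi.zero_apply]
  have hunit : ∀ y, ‖y‖ ≤ 2 * R → IsUnit (cpinf y).det := fun y hy => (hdinf y hy).isUnit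
  have hev : (fun y => (cpinf y)⁻¹ *ᵥ ((2 * Real.pi * Complex.I : ℂ)⁻¹ • circIntV
      (fun t => cp y t *ᵥ PiTV t (fun y => (cp y t)⁻¹ *ᵥ f y) y) ρ)) =ᶠ[𝓝 x] CauchyV g := by
    filter_upwards [Metric.isOpen_ball.mem_nhds (mem_ball_zero_iff.2 hx)] with y hy
    rw [mem_ball_zero_iff] at hy
    rw [circIntV_exterior hρ hy (fun i j => (hsmp i j).continuousOn) hanp hdetp hdinf hfc hfsupp,
      inv_smul_smul₀ Complex.two_pi_I_ne_zero, mulVec_mulVec,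
      Matrix.nonsing_inv_mul _ (hunit y hy.le), one_mulVec]
  rw [dzbarV_congr hev, dzbarV_cauchyV hg hgc, mulVec_mulVec,
    Matrix.mul_nonsing_inv _ (hunit x hx.le), one_mulVec]
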